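/- arXiv:2010.12538 — 2 statements merged into one kernel-verified Lean document; each statement's English description precedes it below -/
import Mathlib

section
/- Fountain Theorem: Let X be an infinite-dimensional real Banach space that is the closure of the direct sum of a sequence of finite-dimensional subspaces (X_i)_{i≥1}; set Y_k = X_1 ⊕ ... ⊕ X_k and Z_k = the closure of the direct sum of the X_i for i ≥ k. Let φ : X → ℝ be a C¹ functional with φ(−u) = φ(u) for all u ∈ X. Assume: (A1) φ satisfies the Palais–Smale condition at every level c > 0 (every sequence (u_n) with φ(u_n) → c and φ′(u_n) → 0 in X* has a convergent subsequence); and for every k ∈ ℕ there exist ρ_k > r_k > 0 such that (A2) a_k := max{φ(u) : u ∈ Y_k, ‖u‖ = ρ_k} ≤ 0, and (A3) b_k := inf{φ(u) : u ∈ Z_k, ‖u‖ = r_k} → +∞ as k → ∞. Then φ has a sequence of critical points (u_k) (i.e. φ′(u_k) = 0) such that φ(u_k) → +∞. -/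
open Filter Topology

/-- The even endpoint of the unit interval `[a, a + 1]`. -/
def evenEnd (a : ℤ) : ℤ := if Even a then a else a + 1

/-- The odd endpoint of the unit interval `[a, a + 1]`. -/
def oddEnd (a : ℤ) : ℤ := if Even a then a + 1 else a

/-- The vertices of the simplex attached to the unit cube with lower corner `a` and the ordering
`ρ` of the coordinates: coordinates change from even to odd, one at a time. -/
def cellVertex {n : ℕ} (a : Fin n → ℤ) (ρ : Equiv.Perm (Fin n)) (k : ℕ) : Fin n → ℤ :=
  fun i => if (ρ i : ℕ) < k then oddEnd (a i) else evenEnd (a i)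

/-- The simplices of the union jack triangulation of the cube `[-N, N]ⁿ`. -/
noncomputable def cells (n : ℕ) (N : ℤ) : Finset ((Fin n → ℤ) × Equiv.Perm (Fin n)) :=
  (Fintype.piFinset fun _ => Finset.Ico (-N) N) ×ˢ Finset.univ

theorem mem_cells {n : ℕ} {N : ℤ} {σ : (Fin n → ℤ) × Equiv.Perm (Fin n)} :
    σ ∈ cells n N ↔ ∀ i, -N ≤ σ.1 i ∧ σ.1 i < N := by
  simp [cells]

theorem evenEnd_neg (a : ℤ) : evenEnd (-1 - a) = -evenEnd a := by
  unfold evenEnd; split_ifs <;> grind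

theorem oddEnd_neg (a : ℤ) : oddEnd (-1 - a) = -oddEnd a := by
  unfold oddEnd; split_ifs <;> grind

theorem cellVertex_neg {n : ℕ} (a : Fin n → ℤ) (ρ : Equiv.Perm (Fin n)) (k : ℕ) :
    cellVertex (fun i => -1 - a i) ρ k = -cellVertex a ρ k := by
  ext i
  simp only [cellVertex, Pi.neg_apply, evenEnd_neg, oddEnd_neg]
  split_ifs <;> rfl

theorem abs_cellVertex_le {n : ℕ} {N : ℤ} {a : Fin n → ℤ} (ha : ∀ i, -N ≤ a i ∧ a i < N)
    (ρ : Equiv.Perm (Fin n)) (k : ℕ) (i : Fin n) : |cellVertex a ρ k i| ≤ N := by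
  have := ha i
  rw [abs_le]
  unfold cellVertex evenEnd oddEnd
  split_ifs <;> constructor <;> omega

theorem abs_cellVertex_sub_le {n : ℕ} (a : Fin n → ℤ) (ρ : Equiv.Perm (Fin n)) (j k : ℕ)
    (i : Fin n) : |cellVertex a ρ j i - cellVertex a ρ k i| ≤ 1 := by
  unfold cellVertex evenEnd oddEnd
  rw [abs_le]
  split_ifs <;> constructor <;> omega

/-- The other unit interval with the same even endpoint. -/
def evenReflect (a : ℤ) : ℤ := 2 * evenEnd a - 1 - a

/-- The other unit interval with the same odd endpoint. -/
def oddReflect (a : ℤ) : ℤ := 2 * oddEnd a - 1 - a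

theorem evenEnd_evenReflect (a : ℤ) : evenEnd (evenReflect a) = evenEnd a := by
  unfold evenReflect evenEnd; split_ifs <;> grind

theorem oddEnd_oddReflect (a : ℤ) : oddEnd (oddReflect a) = oddEnd a := by
  unfold oddReflect oddEnd; split_ifs <;> grind

theorem evenReflect_evenReflect (a : ℤ) : evenReflect (evenReflect a) = a := by
  rw [evenReflect, evenEnd_evenReflect, evenReflect]; ring

theorem oddReflect_oddReflect (a : ℤ) : oddReflect (oddReflect a) = a := by
  rw [oddReflect, oddEnd_oddReflect, oddReflect]; ring

theorem evenReflect_ne (a : ℤ) : evenReflect a ≠ a := by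
  unfold evenReflect; omega

theorem oddReflect_ne (a : ℤ) : oddReflect a ≠ a := by
  unfold oddReflect; omega

theorem evenReflect_mem {N a : ℤ} (hN : Odd N) (ha : -N ≤ a ∧ a < N) :
    -N ≤ evenReflect a ∧ evenReflect a < N := by
  unfold evenReflect evenEnd; split_ifs <;> constructor <;> grind

theorem oddReflect_mem {N a : ℤ} (ha : -N ≤ a ∧ a < N) (h : |oddEnd a| ≠ N) :
    -N ≤ oddReflect a ∧ oddReflect a < N := by
  have : oddEnd a ≠ N ∧ oddEnd a ≠ -N := by
    constructor <;> (intro h'; apply h; rw [h']) <;> simp <;> omega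
  unfold oddReflect
  have h2 : oddEnd a = a ∨ oddEnd a = a + 1 := by unfold oddEnd; split_ifs <;> simp
  omega

theorem sum_cells_eq_zero_of_vertex_unused {n : ℕ} {N : ℤ} (hN : Odd N) (k : Fin n)
    (H : (Fin n → ℤ) × Equiv.Perm (Fin n) → ZMod 2)
    (hH : ∀ σ τ, (∀ j : ℕ, j ≤ n → j ≠ k + 1 → cellVertex σ.1 σ.2 j = cellVertex τ.1 τ.2 j) →
      H σ = H τ) :
    ∑ σ ∈ cells n N, H σ = 0 := by
  by_cases hk : (k : ℕ) + 1 < n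
  · refine Finset.sum_involution (fun σ _ => (σ.1, Equiv.swap k ⟨k + 1, hk⟩ * σ.2)) ?_ ?_ ?_ ?_
    · intro σ _
      rw [hH (σ.1, Equiv.swap k ⟨k + 1, hk⟩ * σ.2) σ, CharTwo.add_self_eq_zero]
      intro j hjn hj
      ext i
      simp only [cellVertex, Equiv.Perm.mul_apply]
      have : ((Equiv.swap k ⟨k + 1, hk⟩ (σ.2 i) : Fin n) : ℕ) < j ↔ (σ.2 i : ℕ) < j := by
        rw [Equiv.swap_apply_def]
        split_ifs with h1 h2
        · rw [h1]; simp only; omega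
        · rw [h2]; simp only; omega
        · rfl
      simp only [this]
    · intro σ _ _ h
      have h1 := congrArg Prod.snd h
      simp only [mul_eq_right] at h1
      have h2 := Equiv.swap_eq_refl_iff.1 h1
      have := congrArg Fin.val h2
      simp at this
    · intro σ hσ
      exact mem_cells.2 fun i => mem_cells.1 hσ i
    · intro σ _
      simp [← mul_assoc]
  · refine Finset.sum_involution (fun σ _ =>
      (Function.update σ.1 (σ.2.symm k) (evenReflect (σ.1 (σ.2.symm k))), σ.2)) ?_ ?_ ?_ ?_
    · intro σ _
      rw [hH (Function.update σ.1 (σ.2.symm k) (evenReflect (σ.1 (σ.2.symm k))), σ.2) σ,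
        CharTwo.add_self_eq_zero]
      intro j hjn hj
      ext i
      simp only [cellVertex]
      by_cases hi : i = σ.2.symm k
      · subst hi
        simp only [Equiv.apply_symm_apply, Function.update_self, evenEnd_evenReflect]
        rw [if_neg (by omega), if_neg (by omega)]
      · simp [Function.update_of_ne hi]
    · intro σ _ _ h
      have h1 := congrFun (congrArg Prod.fst h) (σ.2.symm k)
      simp only [Function.update_self] at h1
      exact evenReflect_ne _ h1
    · intro σ hσ
      rw [mem_cells] at hσ ⊢
      intro i
      by_cases hi : i = σ.2.symm k
      · subst hi
        simpa using evenReflect_mem hN (hσ _)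
      · simpa [Function.update_of_ne hi] using hσ i
    · intro σ _
      simp [evenReflect_evenReflect]

theorem sum_cells_prod_add {n : ℕ} {N : ℤ} (hN : Odd N) (ε : Fin n → (Fin n → ℤ) → ZMod 2) :
    ∑ σ ∈ cells n N, ∏ k : Fin n,
      (ε k (cellVertex σ.1 σ.2 (k + 1)) + ε k (cellVertex σ.1 σ.2 k)) =
    ∑ σ ∈ cells n N, ∏ k : Fin n, ε k (cellVertex σ.1 σ.2 (k + 1)) := by
  simp_rw [Finset.prod_add]
  rw [Finset.sum_comm, Finset.sum_eq_single Finset.univ]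
  · simp
  · intro t _ ht
    have hne : tᶜ.Nonempty := by
      rw [Finset.nonempty_iff_ne_empty]
      simpa using ht
    refine sum_cells_eq_zero_of_vertex_unused hN (tᶜ.max' hne) _ fun σ τ h => ?_
    have hmax := Finset.mem_compl.1 (Finset.max'_mem _ hne)
    congr 1
    · refine Finset.prod_congr rfl fun i hi => ?_
      rw [h _ i.2]
      intro h'
      apply hmax
      convert hi
      omega
    · refine Finset.prod_congr rfl fun i hi => ?_
      have : i ≤ tᶜ.max' hne := Finset.le_max' _ _ (by simpa using hi)
      rw [h _ i.2.le]
      have := Fin.le_def.1 this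
      omega
  · simp

theorem sum_cells_prod_congr {n : ℕ} (hn : 0 < n) {N : ℤ} (ε ε' : Fin n → (Fin n → ℤ) → ZMod 2)
    (h : ∀ k x, (∀ i, |x i| ≤ N) → (∃ i, |x i| = N) → ε k x = ε' k x) :
    ∑ σ ∈ cells n N, ∏ k : Fin n, ε k (cellVertex σ.1 σ.2 (k + 1)) =
    ∑ σ ∈ cells n N, ∏ k : Fin n, ε' k (cellVertex σ.1 σ.2 (k + 1)) := by
  rw [← sub_eq_zero, ← Finset.sum_sub_distrib]
  have hbd : ∀ σ ∈ cells n N, |oddEnd (σ.1 (σ.2.symm ⟨0, hn⟩))| = N →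
      ∏ k : Fin n, ε k (cellVertex σ.1 σ.2 (k + 1)) =
      ∏ k : Fin n, ε' k (cellVertex σ.1 σ.2 (k + 1)) := by
    intro σ hσ hb
    refine Finset.prod_congr rfl fun k _ => h k _ (abs_cellVertex_le (mem_cells.1 hσ) _ _) ?_
    exact ⟨σ.2.symm ⟨0, hn⟩, by simpa [cellVertex] using hb⟩
  refine Finset.sum_involution (fun σ _ =>
    if |oddEnd (σ.1 (σ.2.symm ⟨0, hn⟩))| = N then σ else
    (Function.update σ.1 (σ.2.symm ⟨0, hn⟩) (oddReflect (σ.1 (σ.2.symm ⟨0, hn⟩))), σ.2)) ?_ ?_ ?_ ?_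
  · intro σ hσ
    split_ifs with hb
    · rw [hbd σ hσ hb]; simp
    · have : ∀ k : Fin n, cellVertex (Function.update σ.1 (σ.2.symm ⟨0, hn⟩)
          (oddReflect (σ.1 (σ.2.symm ⟨0, hn⟩)))) σ.2 (k + 1) = cellVertex σ.1 σ.2 (k + 1) := by
        intro k
        ext i
        by_cases hi : i = σ.2.symm ⟨0, hn⟩
        · subst hi
          simp [cellVertex, oddEnd_oddReflect]
        · simp [cellVertex, Function.update_of_ne hi]
      simp only [this, CharTwo.add_self_eq_zero]
  · intro σ hσ h0 h1
    split_ifs at h1 with hb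
    · exact h0 (by rw [hbd σ hσ hb, sub_self])
    · have h1 := congrFun (congrArg Prod.fst h1) (σ.2.symm ⟨0, hn⟩)
      simp only [Function.update_self] at h1
      exact oddReflect_ne _ h1
  · intro σ hσ
    split_ifs with hb
    · exact hσ
    · rw [mem_cells] at hσ ⊢
      intro i
      by_cases hi : i = σ.2.symm ⟨0, hn⟩
      · subst hi
        simpa using oddReflect_mem (hσ _) hb
      · simpa [Function.update_of_ne hi] using hσ i
  · intro σ hσ
    by_cases hb : |oddEnd (σ.1 (σ.2.symm ⟨0, hn⟩))| = N
    · simp [hb]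
    · simp [hb, oddEnd_oddReflect, oddReflect_oddReflect]

theorem zmod_two_add_eq_one_iff {x y : ZMod 2} : x + y = 1 ↔ x ≠ y := by
  revert x y; decide

theorem zmod_two_prod_eq_one_iff {ι : Type*} {s : Finset ι} {f : ι → ZMod 2} :
    ∏ i ∈ s, f i = 1 ↔ ∀ i ∈ s, f i = 1 := by
  have h : ∀ x : ZMod 2, x = 1 ↔ x ≠ 0 := by decide
  rw [h, Finset.prod_ne_zero_iff]
  simp only [h]

theorem oddEnd_ne_zero (a : ℤ) : oddEnd a ≠ 0 := by
  unfold oddEnd; split_ifs <;> grind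

/-- For the sign functions of the coordinates there is exactly one alternating cell. -/
theorem sum_cells_prod_add_sign {n : ℕ} {N : ℤ} (hN : 1 < N)
    (ε : Fin n → (Fin n → ℤ) → ZMod 2)
    (hε : ∀ k x, x k ≠ 0 → ε k x = if 0 < x k then 1 else 0)
    (hε0 : ∀ k x, (∀ i, |x i| ≤ 1) → x k = 0 → ε k x = 0) :
    ∑ σ ∈ cells n N, ∏ k : Fin n,
      (ε k (cellVertex σ.1 σ.2 (k + 1)) + ε k (cellVertex σ.1 σ.2 k)) = 1 := by
  rw [Finset.sum_eq_single_of_mem (0, 1)]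
  · rw [zmod_two_prod_eq_one_iff]
    intro k _
    rw [hε k, hε0 k]
    · simp [cellVertex, oddEnd]
    · intro i
      have := abs_cellVertex_le (N := 1) (a := 0) (by simp) (1 : Equiv.Perm (Fin n)) k i
      simpa using this
    · simp [cellVertex, evenEnd]
    · simp [cellVertex, oddEnd]
  · rw [mem_cells]
    simp; omega
  · rintro ⟨a, ρ⟩ _ hne
    have h01 : ∀ x : ZMod 2, x ≠ 1 → x = 0 := by decide
    refine h01 _ fun hprod => hne ?_
    rw [zmod_two_prod_eq_one_iff] at hprod
    have hch : ∀ k : Fin n, ε k (cellVertex a ρ (k + 1)) ≠ ε k (cellVertex a ρ k) :=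
      fun k => zmod_two_add_eq_one_iff.1 (hprod k (Finset.mem_univ k))
    have key : ∀ j : ℕ, ∀ k : Fin n, n ≤ k + 1 + j → ρ k = k ∧ evenEnd (a k) = 0 := by
      intro j
      induction j using Nat.strong_induction_on with
      | _ j ih =>
        intro k hk
        have hup : ∀ i : Fin n, k < i → ρ i = i := by
          intro i hi
          have hi' := Fin.lt_def.1 hi
          exact (ih (j - 1 - (i - k - 1)) (by omega) i (by omega)).1
        have hle : ρ k ≤ k := by
          by_contra! hlt
          have := ρ.injective (hup _ hlt)
          exact hlt.ne' this
        have hle' := Fin.le_def.1 hle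
        have hval : cellVertex a ρ (k + 1) k = oddEnd (a k) := by
          simp only [cellVertex]; rw [if_pos (by omega)]
        have hne0 := oddEnd_ne_zero (a k)
        have hc := hch k
        rw [hε k _ (by rwa [hval]), hval] at hc
        have hρ : ρ k = k := by
          by_contra hne
          have hlt : (ρ k : ℕ) < k := by
            rcases hle'.lt_or_eq with h | h
            · exact h
            · exact absurd (Fin.ext h) hne
          have hval' : cellVertex a ρ k k = oddEnd (a k) := by
            simp only [cellVertex]; rw [if_pos hlt]
          rw [hε k _ (by rwa [hval']), hval'] at hc
          exact hc rfl
        refine ⟨hρ, ?_⟩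
        by_contra he
        have hval' : cellVertex a ρ k k = evenEnd (a k) := by
          simp only [cellVertex]; rw [if_neg (by simp [hρ])]
        rw [hε k _ (by rwa [hval']), hval'] at hc
        apply hc
        have : 0 < oddEnd (a k) ↔ 0 < evenEnd (a k) := by
          revert he hne0
          unfold evenEnd oddEnd
          split_ifs <;> omega
        simp only [this]
    have hρ : ρ = 1 := by
      ext k
      simp [(key n k (by omega)).1]
    have he : ∀ k, evenEnd (a k) = 0 := fun k => (key n k (by omega)).2
    have ha : ∀ k, -1 ≤ a k ∧ a k < 1 := by
      intro k
      have := he k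
      unfold evenEnd at this
      split_ifs at this <;> omega
    have : a = 0 := by
      ext k
      have hc := hch k
      subst hρ
      rw [hε0 k (cellVertex a 1 k) (fun i => abs_cellVertex_le ha _ _ i) (by simp [cellVertex, he]),
        hε k _ (by simp [cellVertex, oddEnd_ne_zero])] at hc
      have hpos : 0 < oddEnd (a k) := by
        by_contra hp
        simp [cellVertex, hp] at hc
      have := he k
      have := ha k
      simp only [Pi.zero_apply]
      unfold oddEnd at hpos
      split_ifs at hpos with hev
      · grind
      · omega
    rw [this, hρ]

/-- A combinatorial Borsuk–Ulam theorem: a sign labelling which agrees with the signs of the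
coordinates on the boundary of the cube has an alternating cell with a vertex at which the
labelling is not odd. -/
theorem exists_alternating_cell {n : ℕ} (hn : 0 < n) {N : ℤ} (hN : Odd N) (hN1 : 1 < N)
    (ε : Fin n → (Fin n → ℤ) → ZMod 2)
    (hbd : ∀ k x, (∀ i, |x i| ≤ N) → (∃ i, |x i| = N) → x k ≠ 0 →
      ε k x = if 0 < x k then 1 else 0) :
    ∃ (a : Fin n → ℤ) (ρ : Equiv.Perm (Fin n)), (∀ i, -N ≤ a i ∧ a i < N) ∧
      (∀ k : Fin n, ε k (cellVertex a ρ (k + 1)) ≠ ε k (cellVertex a ρ k)) ∧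
      ∃ (j : ℕ) (k : Fin n), ε k (-cellVertex a ρ j) ≠ ε k (cellVertex a ρ j) + 1 := by
  classical
  let ε' : Fin n → (Fin n → ℤ) → ZMod 2 := fun k x =>
    if x k = 0 then (if ∃ i, |x i| = N then ε k x else 0) else if 0 < x k then 1 else 0
  have hsum : ∑ σ ∈ cells n N, ∏ k : Fin n,
      (ε k (cellVertex σ.1 σ.2 (k + 1)) + ε k (cellVertex σ.1 σ.2 k)) = 1 := by
    rw [sum_cells_prod_add hN, sum_cells_prod_congr hn ε ε', ← sum_cells_prod_add hN]
    · refine sum_cells_prod_add_sign hN1 ε' ?_ ?_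
      · intro k x hx
        simp [ε', hx]
      · intro k x hx hk
        have : ¬ ∃ i, |x i| = N := by
          rintro ⟨i, hi⟩
          have := hx i
          omega
        simp [ε', hk, this]
    · intro k x hx hb
      by_cases hk : x k = 0
      · simp only [ε', if_pos hk, if_pos hb]
      · simp only [ε', if_neg hk, hbd k x hx hb hk]
  by_contra! hcon
  have hneg : ∀ σ ∈ cells n N,
      ∏ k : Fin n, (ε k (cellVertex σ.1 σ.2 (k + 1)) + ε k (cellVertex σ.1 σ.2 k)) = 1 →
      ∏ k : Fin n, (ε k (cellVertex (fun i => -1 - σ.1 i) σ.2 (k + 1)) +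
        ε k (cellVertex (fun i => -1 - σ.1 i) σ.2 k)) = 1 := by
    intro σ hσ h1
    have h1' := zmod_two_prod_eq_one_iff.1 h1
    have hodd := hcon σ.1 σ.2 (mem_cells.1 hσ)
      (fun k => zmod_two_add_eq_one_iff.1 (h1' k (Finset.mem_univ k)))
    rw [← h1]
    refine Finset.prod_congr rfl fun k _ => ?_
    rw [cellVertex_neg, cellVertex_neg, hodd, hodd]
    generalize ε k _ = x
    generalize ε k _ = y
    revert x y; decide
  have hmem : ∀ σ ∈ cells n N, ((fun i => -1 - σ.1 i, σ.2) : _ × _) ∈ cells n N := by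
    intro σ hσ
    rw [mem_cells] at hσ ⊢
    intro i
    have := hσ i
    constructor <;> simp only <;> omega
  refine zero_ne_one (α := ZMod 2) (hsum ▸ ?_)
  symm
  refine Finset.sum_involution (fun σ _ => (fun i => -1 - σ.1 i, σ.2)) ?_ ?_ hmem ?_
  · intro σ hσ
    have h1 := hneg σ hσ
    have h2 := hneg _ (hmem σ hσ)
    simp only [sub_sub_cancel] at h2
    revert h1 h2
    generalize (∏ k : Fin n, _ : ZMod 2) = x
    generalize (∏ k : Fin n, _ : ZMod 2) = y
    revert x y; decide
  · intro σ _ _ h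
    have := congrFun (congrArg Prod.fst h) ⟨0, hn⟩
    simp only at this
    omega
  · intro σ _
    simp

/-- A sign choice on the nonzero integer vectors which gives priority to the last coordinate. -/
theorem exists_odd_sign (m : ℕ) : ∃ τ : (Fin (m + 1) → ℤ) → Prop,
    (∀ x, x ≠ 0 → (τ (-x) ↔ ¬ τ x)) ∧ ∀ x, x (Fin.last m) ≠ 0 → (τ x ↔ 0 < x (Fin.last m)) := by
  refine ⟨fun x => 0 < x (Fin.last m) ∨ (x (Fin.last m) = 0 ∧ 0 < toLex x), ?_, ?_⟩
  · intro x hx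
    have hx' : toLex x ≠ 0 := fun h => hx (toLex.injective h)
    have h1 : 0 < toLex (-x) ↔ ¬ 0 < toLex x := by
      rw [show toLex (-x) = -toLex x from rfl, neg_pos (a := toLex x)]
      exact ⟨fun h => h.le.not_gt, fun h => (not_lt.1 h).lt_of_ne hx'⟩
    simp only [Pi.neg_apply, h1]
    by_cases h0 : x (Fin.last m) = 0
    · simp [h0]
    · simp only [neg_eq_zero, h0, false_and, or_false]
      omega
  · intro x hx
    simp [hx]

theorem exists_near_zero_of_odd_of_even {m : ℕ} {F : (Fin (m + 1) → ℝ) → Fin m → ℝ}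
    (hFodd : ∀ x, F (-x) = -F x) (hFbd : ∀ x, ‖x‖ = 1 → ∀ i, F x i = x i.castSucc)
    {η : (Fin (m + 1) → ℝ) → ℝ} (hηeven : ∀ x, η (-x) = η x)
    (hη0 : η 0 < 0) (hηbd : ∀ x, ‖x‖ = 1 → 0 < η x) (p : ℕ) :
    ∃ x : Fin (m + 1) → ℝ, ‖x‖ ≤ 1 ∧
      (∀ i, ∃ y z, dist y x ≤ 1 / ((p : ℝ) + 1) ∧ dist z x ≤ 1 / ((p : ℝ) + 1) ∧
        F y i ≤ 0 ∧ 0 ≤ F z i) ∧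
      ∃ y z, dist y x ≤ 1 / ((p : ℝ) + 1) ∧ dist z x ≤ 1 / ((p : ℝ) + 1) ∧ η y ≤ 0 ∧ 0 ≤ η z := by
  classical
  obtain ⟨τ, hτ, hτlast⟩ := exists_odd_sign m
  set N : ℤ := 2 * p + 3 with hNdef
  have hNodd : Odd N := ⟨p + 1, by rw [hNdef]; ring⟩
  have hN1 : 1 < N := by omega
  have hN0 : (0 : ℝ) < N := by exact_mod_cast (by omega : 0 < N)
  have hNp : (1 : ℝ) / N ≤ 1 / ((p : ℝ) + 1) := by
    apply one_div_le_one_div_of_le (by positivity)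
    rw [hNdef]; push_cast; linarith [(Nat.cast_nonneg p : (0 : ℝ) ≤ p)]
  let s : (Fin (m + 1) → ℤ) → Fin (m + 1) → ℝ := fun x i => (x i : ℝ) / N
  have hsneg : ∀ x, s (-x) = -s x := fun x => by ext i; simp [s, neg_div]
  have hs0 : s 0 = 0 := by ext i; simp [s]
  have hsle : ∀ x, (∀ i, |x i| ≤ N) → ‖s x‖ ≤ 1 := by
    intro x hx
    refine (pi_norm_le_iff_of_nonneg zero_le_one).2 fun i => ?_
    rw [Real.norm_eq_abs, abs_div, abs_of_pos hN0, div_le_one hN0]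
    exact_mod_cast hx i
  have hsbd : ∀ x, (∀ i, |x i| ≤ N) → (∃ i, |x i| = N) → ‖s x‖ = 1 := by
    rintro x hx ⟨i, hi⟩
    refine le_antisymm (hsle x hx) ?_
    refine le_trans ?_ (norm_le_pi_norm (s x) i)
    rw [Real.norm_eq_abs, abs_div, abs_of_pos hN0, one_le_div hN0]
    exact_mod_cast hi.ge
  let ε : Fin (m + 1) → (Fin (m + 1) → ℤ) → ZMod 2 := Fin.lastCases
    (fun x => if 0 < η (s x) → τ x then 1 else 0)
    (fun i x => if 0 < F (s x) i ∨ (F (s x) i = 0 ∧ τ x) then 1 else 0)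
  have hεlast : ∀ x, ε (Fin.last m) x = if 0 < η (s x) → τ x then 1 else 0 := fun x => by
    simp [ε]
  have hεcast : ∀ (i : Fin m) x, ε i.castSucc x =
      if 0 < F (s x) i ∨ (F (s x) i = 0 ∧ τ x) then 1 else 0 := fun i x => by
    simp [ε]
  obtain ⟨a, ρ, ha, halt, j, k, hjk⟩ := exists_alternating_cell (Nat.succ_pos m) hNodd hN1 ε (by
    intro k x hx hb hk
    have h1 := hsbd x hx hb
    induction k using Fin.lastCases with
    | last =>
      rw [hεlast]
      simp [hηbd _ h1, hτlast x hk]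
    | cast i =>
      have hk' : (x i.castSucc : ℝ) / N ≠ 0 := div_ne_zero (by exact_mod_cast hk) hN0.ne'
      rw [hεcast, hFbd _ h1]
      simp only [s, hk', false_and, or_false]
      simp only [div_pos_iff_of_pos_right hN0, Int.cast_pos])
  have hdist : ∀ l, dist (s (cellVertex a ρ l)) (s (cellVertex a ρ 0)) ≤ 1 / ((p : ℝ) + 1) := by
    intro l
    refine le_trans ((dist_pi_le_iff (by positivity)).2 fun i => ?_) hNp
    simp only [s]
    rw [Real.dist_eq, ← sub_div, abs_div, abs_of_pos hN0]
    gcongr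
    exact_mod_cast abs_cellVertex_sub_le a ρ l 0 i
  have hηpos_odd : ∀ x k, 0 < η (s x) → ε k (-x) = ε k x + 1 := by
    intro x k hx
    have hx0 : x ≠ 0 := by
      rintro rfl
      rw [hs0] at hx
      exact hx.not_gt hη0
    induction k using Fin.lastCases with
    | last =>
      rw [hεlast, hεlast, hsneg, hηeven, hτ x hx0]
      by_cases h : τ x <;> simp [hx, h]; rfl
    | cast i =>
      rw [hεcast, hεcast, hsneg, hFodd, hτ x hx0, Pi.neg_apply]
      rcases lt_trichotomy (F (s x) i) 0 with h | h | h
      · simp [h, h.ne, h.not_gt]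
      · by_cases h' : τ x <;> simp [h, h']; rfl
      · simp [h, h.ne', h.not_gt]; rfl
  refine ⟨s (cellVertex a ρ 0), hsle _ (abs_cellVertex_le ha ρ 0), ?_, ?_⟩
  · intro i
    have hne := halt i.castSucc
    rw [hεcast, hεcast] at hne
    have hsgn : ∀ x y, (0 < F (s x) i ∨ (F (s x) i = 0 ∧ τ x)) →
        ¬ (0 < F (s y) i ∨ (F (s y) i = 0 ∧ τ y)) → F (s y) i ≤ 0 ∧ 0 ≤ F (s x) i := by
      intro x y h1 h2
      push Not at h2
      refine ⟨h2.1, ?_⟩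
      rcases h1 with h | h
      · exact h.le
      · exact h.1.ge
    split_ifs at hne with h1 h2 h2
    · exact absurd rfl hne
    · exact ⟨_, _, hdist _, hdist _, hsgn _ _ h1 h2⟩
    · exact ⟨_, _, hdist _, hdist _, hsgn _ _ h2 h1⟩
    · exact absurd rfl hne
  · have hnonpos : η (s (cellVertex a ρ j)) ≤ 0 := by
      by_contra! h
      exact hjk (hηpos_odd _ k h)
    have hpos : ∃ l, 0 ≤ η (s (cellVertex a ρ l)) := by
      by_contra! h
      apply halt (Fin.last m)
      rw [hεlast, hεlast]
      simp [(h _).not_gt]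
    obtain ⟨l, hl⟩ := hpos
    exact ⟨_, _, hdist j, hdist l, hnonpos, hl⟩

/-- A form of the Borsuk–Ulam theorem: an odd map to `ℝᵐ` on the cube in `ℝᵐ⁺¹` which is a
coordinate projection on the boundary has a zero on any symmetric hypersurface separating the
origin from the boundary. -/
theorem exists_zero_of_odd_of_even {m : ℕ} {F : (Fin (m + 1) → ℝ) → Fin m → ℝ}
    (hF : Continuous F) (hFodd : ∀ x, F (-x) = -F x)
    (hFbd : ∀ x, ‖x‖ = 1 → ∀ i, F x i = x i.castSucc)
    {η : (Fin (m + 1) → ℝ) → ℝ} (hη : Continuous η) (hηeven : ∀ x, η (-x) = η x)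
    (hη0 : η 0 < 0) (hηbd : ∀ x, ‖x‖ = 1 → 0 < η x) :
    ∃ x, F x = 0 ∧ η x = 0 := by
  choose x hx hxF hxη using exists_near_zero_of_odd_of_even hFodd hFbd hηeven hη0 hηbd
  obtain ⟨x₀, -, σ, hσ, hlim⟩ := (isCompact_closedBall (0 : Fin (m + 1) → ℝ) 1).tendsto_subseq
    (x := x) (fun p => by simpa using hx p)
  have hsmall : Tendsto (fun p => 1 / ((σ p : ℝ) + 1)) atTop (𝓝 0) :=
    tendsto_one_div_add_atTop_nhds_zero_nat.comp hσ.tendsto_atTop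
  have hzero : ∀ G : (Fin (m + 1) → ℝ) → ℝ, Continuous G →
      (∀ p, ∃ y z, dist y (x p) ≤ 1 / ((p : ℝ) + 1) ∧ dist z (x p) ≤ 1 / ((p : ℝ) + 1) ∧
        G y ≤ 0 ∧ 0 ≤ G z) → G x₀ = 0 := by
    intro G hG h
    choose y z hy hz hGy hGz using h
    have hclose : ∀ w : ℕ → Fin (m + 1) → ℝ, (∀ p, dist (w p) (x p) ≤ 1 / ((p : ℝ) + 1)) →
        Tendsto (fun p => w (σ p)) atTop (𝓝 x₀) := by
      intro w hw
      refine tendsto_of_tendsto_of_dist hlim ?_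
      refine squeeze_zero (fun _ => dist_nonneg) (fun p => ?_) hsmall
      rw [dist_comm]
      exact hw (σ p)
    refine le_antisymm ?_ ?_
    · exact le_of_tendsto' ((hG.tendsto x₀).comp (hclose y hy)) fun p => hGy _
    · exact ge_of_tendsto' ((hG.tendsto x₀).comp (hclose z hz)) fun p => hGz _
  refine ⟨x₀, ?_, hzero η hη hxη⟩
  ext i
  exact hzero (fun x => F x i) ((continuous_apply i).comp hF) fun p => hxF p i

/-- Ekeland's variational principle, in its weak form. -/
theorem LowerSemicontinuous.exists_ekeland {M : Type*} [MetricSpace M] [CompleteSpace M]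
    {f : M → ℝ} (hf : LowerSemicontinuous f) (hbdd : BddBelow (Set.range f)) {ε : ℝ} (hε : 0 < ε)
    (x₀ : M) : ∃ x, f x ≤ f x₀ ∧ ∀ y, f x - ε * dist x y ≤ f y := by
  let S : M → Set M := fun x => {y | f y + ε * dist x y ≤ f x}
  have hself : ∀ x, x ∈ S x := fun x => by simp [S]
  have htrans : ∀ x y, y ∈ S x → S y ⊆ S x := by
    intro x y hy z hz
    simp only [S, Set.mem_ofPred_eq] at hy hz ⊢
    nlinarith [dist_triangle x y z]
  have hclosed : ∀ x, IsClosed (S x) := by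
    intro x
    have hc : Continuous fun y => ε * dist x y := by fun_prop
    exact (hf.add hc.lowerSemicontinuous).isClosed_preimage (f x)
  have hnext : ∀ (x : M) (n : ℕ), ∃ y ∈ S x, ∀ z ∈ S x, f y ≤ f z + (1 / 2) ^ n := by
    intro x n
    have hb : BddBelow (f '' S x) := hbdd.mono (Set.image_subset_range _ _)
    obtain ⟨_, ⟨y, hy, rfl⟩, hlt⟩ := exists_lt_of_csInf_lt (Set.Nonempty.image f ⟨x, hself x⟩)
      (lt_add_of_pos_right (sInf (f '' S x)) (by positivity : (0 : ℝ) < (1 / 2) ^ n))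
    exact ⟨y, hy, fun z hz => by linarith [csInf_le hb (Set.mem_image_of_mem f hz)]⟩
  choose next hnextS hnextle using hnext
  let x : ℕ → M := fun n => Nat.rec x₀ (fun n y => next y n) n
  have hsucc : ∀ n, x (n + 1) = next (x n) n := fun n => rfl
  have hanti : Antitone fun n => S (x n) :=
    antitone_nat_of_succ_le fun n => htrans _ _ (by rw [hsucc]; exact hnextS _ _)
  have hdist : ∀ n, ∀ z ∈ S (x (n + 1)), dist (x (n + 1)) z ≤ ε⁻¹ * (1 / 2) ^ n := by
    intro n z hz
    have h1 := hnextle (x n) n z (hanti n.le_succ hz)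
    rw [← hsucc] at h1
    simp only [S, Set.mem_ofPred_eq] at hz
    rw [inv_mul_eq_div, le_div_iff₀ hε]
    linarith
  have hlim0 : Tendsto (fun n : ℕ => ε⁻¹ * (1 / 2 : ℝ) ^ n) atTop (𝓝 0) := by
    simpa using (tendsto_pow_atTop_nhds_zero_of_lt_one (by norm_num : (0 : ℝ) ≤ 1 / 2)
      (by norm_num)).const_mul ε⁻¹
  have hmem : ∀ {n m}, n ≤ m → x m ∈ S (x n) := fun h => hanti h (hself _)
  have hcauchy : CauchySeq fun n => x (n + 1) := by
    refine cauchySeq_of_le_tendsto_0 (fun n => 2 * (ε⁻¹ * (1 / 2) ^ n)) (fun n m N hn hm => ?_)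
      (by simpa using hlim0.const_mul 2)
    have h1 := hdist N _ (hmem (Nat.succ_le_succ hn))
    have h2 := hdist N _ (hmem (Nat.succ_le_succ hm))
    linarith [dist_triangle_left (x (n + 1)) (x (m + 1)) (x (N + 1))]
  obtain ⟨x', hx'⟩ := cauchySeq_tendsto_of_complete hcauchy
  have hx'S : ∀ n, x' ∈ S (x n) := fun n =>
    (hclosed _).mem_of_tendsto hx' ((eventually_ge_atTop n).mono fun m hm => hmem (Nat.le_succ_of_le hm))
  refine ⟨x', ?_, fun y => ?_⟩
  · have := hx'S 0
    simp only [S, Set.mem_ofPred_eq] at this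
    have h0 : x 0 = x₀ := rfl
    rw [h0] at this
    nlinarith [dist_nonneg (x := x₀) (y := x')]
  · by_contra! hlt
    have hy : y ∈ S x' := by
      simp only [S, Set.mem_ofPred_eq]
      linarith
    have hylim : Tendsto (fun n => x (n + 1)) atTop (𝓝 y) := by
      rw [tendsto_iff_dist_tendsto_zero]
      exact squeeze_zero (fun _ => dist_nonneg)
        (fun n => hdist n y (htrans _ _ (hx'S (n + 1)) hy)) hlim0
    rw [tendsto_nhds_unique hx' hylim] at hlt
    simp at hlt

section Minimax

open BoundedContinuousFunction

/-- The odd bounded continuous maps vanishing outside the ball of radius `ρ`. -/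
def oddPerturbations (X E : Type*) [NormedAddCommGroup X] [NormedAddCommGroup E] (ρ : ℝ) :
    Set (E →ᵇ X) :=
  {g | (∀ u, g (-u) = -g u) ∧ ∀ u, ρ ≤ ‖u‖ → g u = 0}

theorem isClosed_oddPerturbations (X E : Type*) [NormedAddCommGroup X] [NormedAddCommGroup E]
    (ρ : ℝ) : IsClosed (oddPerturbations X E ρ) := by
  have hev : ∀ u : E, Continuous fun g : E →ᵇ X => g u := fun u => continuous_eval_const u
  simp only [oddPerturbations, Set.ofPred_and, Set.ofPred_forall]
  refine (isClosed_iInter fun u => isClosed_eq (hev _) (hev _).neg).inter ?_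
  exact isClosed_iInter fun u => isClosed_iInter fun _ => isClosed_eq (hev _) continuous_const

variable {X E : Type*} [NormedAddCommGroup X] [NormedSpace ℝ X] [NormedAddCommGroup E]
  [NormedSpace ℝ E]

/-- The maximum of `φ` along the perturbation `g` of `ι` over the ball of radius `ρ`. -/
noncomputable def maxAlong (φ : X → ℝ) (ι : E →L[ℝ] X) (ρ : ℝ) (g : E →ᵇ X) : ℝ :=
  sSup ((fun u => φ (ι u + g u)) '' Metric.closedBall 0 ρ)

variable {φ : X → ℝ} {ι : E →L[ℝ] X} {ρ : ℝ}

theorem le_maxAlong [ProperSpace E] (hφ : Continuous φ) (g : E →ᵇ X) {u : E} (hu : ‖u‖ ≤ ρ) :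
    φ (ι u + g u) ≤ maxAlong φ ι ρ g := by
  refine le_csSup ?_ (Set.mem_image_of_mem _ (by simpa using hu))
  exact ((isCompact_closedBall _ _).image (by fun_prop)).bddAbove

theorem exists_eq_maxAlong [ProperSpace E] (hφ : Continuous φ) (hρ : 0 ≤ ρ) (g : E →ᵇ X) :
    ∃ u, ‖u‖ ≤ ρ ∧ φ (ι u + g u) = maxAlong φ ι ρ g := by
  obtain ⟨u, hu, h⟩ := ((isCompact_closedBall (0 : E) ρ).image
    (f := fun u => φ (ι u + g u)) (by fun_prop)).sSup_mem
    ((Metric.nonempty_closedBall.2 hρ).image _)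
  exact ⟨u, by simpa using hu, h⟩

theorem continuous_maxAlong [ProperSpace E] (hφ : Continuous φ) :
    Continuous (maxAlong φ ι ρ) := by
  refine (isCompact_closedBall (0 : E) ρ).continuous_sSup
    (f := fun (g : E →ᵇ X) u => φ (ι u + g u)) ?_
  have : Continuous fun p : (E →ᵇ X) × E => p.1 p.2 := continuous_eval
  exact hφ.comp ((ι.continuous.comp continuous_snd).add this)

theorem fderiv_neg_of_even (heven : ∀ u, φ (-u) = φ u) (x : X) :
    fderiv ℝ φ (-x) = -fderiv ℝ φ x := by
  have h := (ContinuousLinearEquiv.neg ℝ (M := X)).comp_right_fderiv (f := φ) (x := x)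
  have heq : φ ∘ ContinuousLinearEquiv.neg ℝ (M := X) = φ := funext heven
  rw [heq] at h
  ext v
  simp [h]

/-- A pseudo-gradient field for `φ` along an odd perturbation `g`, near the points where the
maximum is attained. -/
theorem exists_odd_descent_field (hφ : ContDiff ℝ 1 φ)
    (heven : ∀ u, φ (-u) = φ u) {g : E →ᵇ X} (hg : g ∈ oddPerturbations X E ρ)
    {A : Set E} (hA : IsClosed A) (hAneg : ∀ u ∈ A, -u ∈ A) (hAρ : ∀ u ∈ A, ‖u‖ < ρ) {ε : ℝ}
    (hAε : ∀ u ∈ A, ε < ‖fderiv ℝ φ (ι u + g u)‖) :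
    ∃ V ∈ oddPerturbations X E ρ, ‖V‖ ≤ 1 ∧ ∀ u ∈ A, ε < fderiv ℝ φ (ι u + g u) (V u) := by
  have hdcont : Continuous fun u => fderiv ℝ φ (ι u + g u) :=
    (hφ.continuous_fderiv one_ne_zero).comp (by fun_prop)
  let T : E → Set X := fun u =>
    {v | ‖v‖ ≤ 1 ∧ (u ∈ A → ε < fderiv ℝ φ (ι u + g u) v) ∧ (ρ ≤ ‖u‖ → v = 0)}
  have hTconv : ∀ u, Convex ℝ (T u) := by
    intro u v hv w hw a b ha hb hab
    refine ⟨?_, fun hu => ?_, fun hu => ?_⟩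
    · have := convex_closedBall (0 : X) 1 (by simpa using hv.1) (by simpa using hw.1) ha hb hab
      simpa using this
    · exact (convex_halfSpace_gt (fderiv ℝ φ (ι u + g u)).isLinear ε) (hv.2.1 hu) (hw.2.1 hu)
        ha hb hab
    · simp [hv.2.2 hu, hw.2.2 hu]
  have hTloc : ∀ u, ∃ v, ∀ᶠ y in 𝓝 u, v ∈ T y := by
    intro u
    by_cases hu : u ∈ A
    · obtain ⟨v, hv1, hv⟩ := (fderiv ℝ φ (ι u + g u)).exists_lt_apply_of_lt_opNorm (hAε u hu)
      obtain ⟨v, hv1, hv⟩ : ∃ v, ‖v‖ < 1 ∧ ε < fderiv ℝ φ (ι u + g u) v := by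
        rw [Real.norm_eq_abs, lt_abs] at hv
        rcases hv with hv | hv
        · exact ⟨v, hv1, hv⟩
        · exact ⟨-v, by simpa using hv1, by simpa using hv⟩
      refine ⟨v, ?_⟩
      have hc : Continuous fun y => fderiv ℝ φ (ι y + g y) v := hdcont.clm_apply continuous_const
      filter_upwards [hc.continuousAt.eventually_const_lt hv,
        continuous_norm.continuousAt.eventually_lt_const (hAρ u hu)] with y hy hyρ
      exact ⟨hv1.le, fun _ => hy, fun h => absurd hyρ h.not_gt⟩
    · refine ⟨0, ?_⟩
      filter_upwards [hA.isOpen_compl.mem_nhds hu] with y hy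
      exact ⟨by simp, fun h => absurd h hy, fun _ => rfl⟩
  obtain ⟨V, hV⟩ := exists_continuous_forall_mem_convex_of_local_const hTconv hTloc
  let W : E → X := fun u => (1 / 2 : ℝ) • (V u - V (-u))
  have hWnorm : ∀ u, ‖W u‖ ≤ 1 := by
    intro u
    simp only [W, norm_smul]
    have h1 := (hV u).1
    have h2 := (hV (-u)).1
    have := norm_sub_le (V u) (V (-u))
    norm_num
    linarith
  refine ⟨BoundedContinuousFunction.ofNormedAddCommGroup W (by fun_prop) 1 hWnorm, ⟨?_, ?_⟩,
    BoundedContinuousFunction.norm_ofNormedAddCommGroup_le _ zero_le_one _, ?_⟩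
  · intro u
    simp only [coe_ofNormedAddCommGroup, W, neg_neg, ← smul_neg, neg_sub]
  · intro u hu
    simp [W, (hV u).2.2 hu, (hV (-u)).2.2 (by simpa using hu)]
  · intro u hu
    have h1 := (hV u).2.1 hu
    have h2 := (hV (-u)).2.1 (hAneg u hu)
    rw [hg.1, map_neg, ← neg_add, fderiv_neg_of_even heven] at h2
    simp only [coe_ofNormedAddCommGroup, W, map_smul, map_sub, smul_eq_mul]
    simp only [_root_.neg_apply] at h2
    linarith

/-- At an approximate minimum of `maxAlong`, the maximum is attained at an almost critical
point. -/
theorem exists_norm_fderiv_le_of_ekeland [ProperSpace E] (hφ : ContDiff ℝ 1 φ)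
    (heven : ∀ u, φ (-u) = φ u) (hρ : 0 < ρ) (hφρ : ∀ u, ‖u‖ = ρ → φ (ι u) ≤ 0)
    {g : E →ᵇ X} (hg : g ∈ oddPerturbations X E ρ) (hpos : 0 < maxAlong φ ι ρ g) {ε : ℝ}
    (hε : 0 ≤ ε) (hmin : ∀ g' ∈ oddPerturbations X E ρ,
      maxAlong φ ι ρ g - ε * dist g g' ≤ maxAlong φ ι ρ g') :
    ∃ x, φ x = maxAlong φ ι ρ g ∧ ‖fderiv ℝ φ x‖ ≤ ε := by
  by_contra! hcon
  have hφc := hφ.continuous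
  let A : Set E := {u | ‖u‖ ≤ ρ ∧ φ (ι u + g u) = maxAlong φ ι ρ g}
  have hA : IsClosed A :=
    (isClosed_le continuous_norm continuous_const).inter (isClosed_eq (by fun_prop) (by fun_prop))
  have hAneg : ∀ u ∈ A, -u ∈ A := by
    rintro u ⟨h1, h2⟩
    refine ⟨by simpa using h1, ?_⟩
    rw [hg.1, map_neg, ← neg_add, heven, h2]
  have hAρ : ∀ u ∈ A, ‖u‖ < ρ := by
    rintro u ⟨h1, h2⟩
    refine lt_of_le_of_ne h1 fun h => ?_
    rw [hg.2 u h.ge, add_zero] at h2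
    linarith [hφρ u h]
  obtain ⟨V, hVmem, hV1, hV⟩ := exists_odd_descent_field hφ heven hg hA hAneg hAρ
    fun u hu => hcon _ hu.2
  let t : ℕ → ℝ := fun n => 1 / ((n : ℝ) + 1)
  have ht0 : ∀ n, 0 < t n := fun n => by positivity
  have htlim : Tendsto t atTop (𝓝 0) := tendsto_one_div_add_atTop_nhds_zero_nat
  have hgt : ∀ n, g - t n • V ∈ oddPerturbations X E ρ := by
    refine fun n => ⟨fun u => ?_, fun u hu => ?_⟩
    · simp only [BoundedContinuousFunction.coe_sub, BoundedContinuousFunction.coe_smul,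
        Pi.sub_apply, hg.1, hVmem.1]
      module
    · simp [hg.2 u hu, hVmem.2 u hu]
  choose u huρ hu using fun n => exists_eq_maxAlong (ι := ι) hφc hρ.le (g - t n • V)
  have hVu : ∀ v, ‖V v‖ ≤ 1 := fun v => (V.norm_coe_le_norm v).trans hV1
  have hlow : ∀ n, maxAlong φ ι ρ g - ε * t n ≤ φ (ι (u n) + g (u n) - t n • V (u n)) := by
    intro n
    have h1 := hmin _ (hgt n)
    rw [← hu n, dist_eq_norm, sub_sub_cancel, norm_smul, Real.norm_of_nonneg (ht0 n).le] at h1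
    have h2 : ε * (t n * ‖V‖) ≤ ε * t n := by
      gcongr
      exact mul_le_of_le_one_right (ht0 n).le hV1
    rw [add_sub_assoc]
    simp only [BoundedContinuousFunction.coe_sub, BoundedContinuousFunction.coe_smul,
      Pi.sub_apply] at h1
    linarith
  obtain ⟨w, hw, σ, hσ, hlim⟩ := (isCompact_closedBall (0 : E) ρ).tendsto_subseq
    (x := u) (fun n => by simpa using huρ n)
  have htσ : Tendsto (fun n => t (σ n)) atTop (𝓝 0) := htlim.comp hσ.tendsto_atTop
  have hγlim : Tendsto (fun n => ι (u (σ n)) + g (u (σ n))) atTop (𝓝 (ι w + g w)) :=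
    ((by fun_prop : Continuous fun v => ι v + g v).tendsto w).comp hlim
  have hVlim : Tendsto (fun n => V (u (σ n))) atTop (𝓝 (V w)) := (V.continuous.tendsto w).comp hlim
  have hγtlim : Tendsto (fun n => ι (u (σ n)) + g (u (σ n)) - t (σ n) • V (u (σ n))) atTop
      (𝓝 (ι w + g w)) := by
    simpa using hγlim.sub (htσ.smul hVlim)
  have hwA : w ∈ A := by
    have hwρ : ‖w‖ ≤ ρ := by simpa using hw
    refine ⟨hwρ, le_antisymm (le_maxAlong hφc g hwρ) ?_⟩
    have h1 : Tendsto (fun n => maxAlong φ ι ρ g - ε * t (σ n)) atTop (𝓝 (maxAlong φ ι ρ g)) := by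
      simpa using (htσ.const_mul ε).const_sub (maxAlong φ ι ρ g)
    exact le_of_tendsto_of_tendsto' h1 ((hφc.tendsto _).comp hγtlim) fun n => hlow _
  have hstrict : HasStrictFDerivAt φ (fderiv ℝ φ (ι w + g w)) (ι w + g w) :=
    hφ.contDiffAt.hasStrictFDerivAt one_ne_zero
  refine (hV w hwA).not_ge (le_of_forall_pos_le_add fun c hc => ?_)
  have hev := (hγtlim.prodMk_nhds hγlim).eventually (hstrict.isLittleO.def hc)
  refine le_of_tendsto (((fderiv ℝ φ (ι w + g w)).continuous.tendsto _).comp hVlim) ?_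
  filter_upwards [hev] with n hn
  have hT := ht0 (σ n)
  rw [sub_sub_cancel_left, map_neg, map_smul, norm_neg, norm_smul, Real.norm_of_nonneg hT.le,
    Real.norm_eq_abs, smul_eq_mul] at hn
  have h1 := (le_abs_self _).trans hn
  have h2 := hlow (σ n)
  have h3 := le_maxAlong (ι := ι) hφc g (huρ (σ n))
  have h4 : c * (t (σ n) * ‖V (u (σ n))‖) ≤ c * t (σ n) := by
    gcongr
    exact mul_le_of_le_one_right hT.le (hVu _)
  simp only [Function.comp_apply]
  refine le_of_mul_le_mul_left ?_ hT
  linarith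

/-- The symmetric minimax principle: it produces a Palais–Smale sequence. -/
theorem exists_palaisSmale_of_minimax [CompleteSpace X] [ProperSpace E] (hφ : ContDiff ℝ 1 φ)
    (heven : ∀ u, φ (-u) = φ u) (hρ : 0 < ρ) (hφρ : ∀ u, ‖u‖ = ρ → φ (ι u) ≤ 0) {M : ℝ}
    (hM : 0 < M) (hlink : ∀ g ∈ oddPerturbations X E ρ, ∃ u, ‖u‖ ≤ ρ ∧ M ≤ φ (ι u + g u)) :
    ∃ c, M ≤ c ∧ ∃ x : ℕ → X, Tendsto (fun n => φ (x n)) atTop (𝓝 c) ∧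
      Tendsto (fun n => ‖fderiv ℝ φ (x n)‖) atTop (𝓝 0) := by
  have hφc := hφ.continuous
  let Γ := oddPerturbations X E ρ
  have : CompleteSpace Γ := (isClosed_oddPerturbations X E ρ).completeSpace_coe
  have : Nonempty Γ := ⟨⟨0, by simp [Γ, oddPerturbations]⟩⟩
  let Ψ : Γ → ℝ := fun g => maxAlong φ ι ρ g
  have hΨ : Continuous Ψ := (continuous_maxAlong hφc).comp continuous_subtype_val
  have hMΨ : ∀ g, M ≤ Ψ g := by
    intro g
    obtain ⟨u, hu, h⟩ := hlink g g.2
    exact h.trans (le_maxAlong hφc _ hu)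
  have hbdd : BddBelow (Set.range Ψ) := ⟨M, by rintro _ ⟨g, rfl⟩; exact hMΨ g⟩
  have hstep : ∀ n : ℕ, ∃ x, iInf Ψ ≤ φ x ∧ φ x ≤ iInf Ψ + 1 / ((n : ℝ) + 1) ∧
      ‖fderiv ℝ φ x‖ ≤ 1 / ((n : ℝ) + 1) := by
    intro n
    have hn : (0 : ℝ) < 1 / ((n : ℝ) + 1) := by positivity
    obtain ⟨g₀, hg₀⟩ := exists_lt_of_ciInf_lt (lt_add_of_pos_right (iInf Ψ) hn)
    obtain ⟨g, hg, hmin⟩ := hΨ.lowerSemicontinuous.exists_ekeland hbdd hn g₀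
    obtain ⟨x, hx, hx'⟩ := exists_norm_fderiv_le_of_ekeland hφ heven hρ hφρ g.2
      (hM.trans_le (hMΨ g)) hn.le fun g' hg' => hmin ⟨g', hg'⟩
    exact ⟨x, hx ▸ ciInf_le hbdd g, hx ▸ hg.trans hg₀.le, hx'⟩
  choose x hx1 hx2 hx3 using hstep
  have hlim : Tendsto (fun n : ℕ => 1 / ((n : ℝ) + 1)) atTop (𝓝 0) :=
    tendsto_one_div_add_atTop_nhds_zero_nat
  refine ⟨iInf Ψ, le_ciInf hMΨ, x, ?_, squeeze_zero (fun _ => norm_nonneg _) hx3 hlim⟩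
  exact tendsto_of_tendsto_of_tendsto_of_le_of_le tendsto_const_nhds
    (by simpa using hlim.const_add (iInf Ψ)) hx1 hx2

end Minimax

/-- An odd map of a finite-dimensional space which is the identity outside a ball meets every
small sphere of a closed subspace whose codimension is less than the dimension. -/
theorem exists_mem_norm_eq_of_odd {X : Type*} [NormedAddCommGroup X] [NormedSpace ℝ X]
    {Y Z : Submodule ℝ X} [FiniteDimensional ℝ Y] (hZ : IsClosed (Z : Set X)) (hYZ : Y ⊔ Z = ⊤)
    (hinf : Y ⊓ Z ≠ ⊥) {ρ r : ℝ} (hr : 0 < r) (hrρ : r < ρ) {γ : Y → X} (hγ : Continuous γ)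
    (hodd : ∀ u, γ (-u) = -γ u) (hρ : ∀ u : Y, ρ ≤ ‖u‖ → γ u = u) :
    ∃ u : Y, ‖u‖ ≤ ρ ∧ γ u ∈ Z ∧ ‖γ u‖ = r := by
  have : IsClosed (Z : Set X) := hZ
  have hsurj : Function.Surjective (Z.mkQ ∘ₗ Y.subtype) := by
    rw [← LinearMap.range_eq_top, LinearMap.range_comp, Submodule.range_subtype,
      Submodule.map_mkQ_eq_top, sup_comm, hYZ]
  have : FiniteDimensional ℝ (X ⧸ Z) := Module.Finite.of_surjective _ hsurj
  obtain ⟨y₀, hy₀, hy₀0⟩ := Submodule.exists_mem_ne_zero_of_ne_bot hinf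
  let b := Module.finBasis ℝ (X ⧸ Z)
  set m := Module.finrank ℝ (X ⧸ Z)
  choose y hy using fun i => hsurj (b i)
  let L : X →L[ℝ] Fin m → ℝ :=
    (LinearMap.toContinuousLinearMap b.equivFun.toLinearMap) ∘L Z.mkQL
  have hLZ : ∀ x, L x = 0 → x ∈ Z := by
    intro x hx
    have : b.equivFun (Z.mkQ x) = 0 := hx
    simpa using this
  have hLy : ∀ i, L (y i) = Pi.single i 1 := by
    intro i
    have : L (y i) = b.equivFun (Z.mkQ (y i)) := rfl
    rw [this, show Z.mkQ (y i) = b i from hy i]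
    ext j
    simp [Pi.single_apply, eq_comm]
  have hLy₀ : L y₀ = 0 := by
    have : L y₀ = b.equivFun (Z.mkQ y₀) := rfl
    rw [this, (Submodule.Quotient.mk_eq_zero Z).2 hy₀.2 |> fun h => (h : Z.mkQ y₀ = 0), map_zero]
  let Y₀ : Fin (m + 1) → Y := Fin.snoc y ⟨y₀, hy₀.1⟩
  let e : (Fin (m + 1) → ℝ) →L[ℝ] Y := LinearMap.toContinuousLinearMap (Fintype.linearCombination ℝ Y₀)
  have he : ∀ x, e x = (∑ i : Fin m, x i.castSucc • y i) + x (Fin.last m) • ⟨y₀, hy₀.1⟩ := by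
    intro x
    simp [e, Y₀, Fintype.linearCombination_apply, Fin.sum_univ_castSucc]
  have hLe : ∀ x i, L (e x) i = x i.castSucc := by
    intro x i
    rw [he]
    simp [hLy, hLy₀, Finset.sum_apply, Pi.single_apply]
  have heinj : LinearMap.ker (e : (Fin (m + 1) → ℝ) →ₗ[ℝ] Y) = ⊥ := by
    rw [LinearMap.ker_eq_bot']
    intro x hx
    have hx : e x = 0 := hx
    have h1 : ∀ i : Fin m, x i.castSucc = 0 := fun i => by rw [← hLe x i, hx]; simp
    have h2 := he x
    rw [hx] at h2
    simp only [h1, zero_smul, Finset.sum_const_zero, zero_add] at h2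
    have h3 : x (Fin.last m) = 0 := by
      rcases smul_eq_zero.1 h2.symm with h | h
      · exact h
      · exact absurd (congrArg Subtype.val h) hy₀0
    ext i
    induction i using Fin.lastCases with
    | last => exact h3
    | cast i => exact h1 i
  obtain ⟨K, hK0, hK⟩ := (e : (Fin (m + 1) → ℝ) →ₗ[ℝ] Y).exists_antilipschitzWith heinj
  have hρ0 : 0 < ρ := hr.trans hrρ
  have hK0' : (0 : ℝ) < K := hK0
  set R : ℝ := ρ * K
  have hR : 0 < R := by positivity
  have hlarge : ∀ x, ‖x‖ = 1 → ρ ≤ ‖e (R • x)‖ := by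
    intro x hx
    have h := hK.le_mul_dist (R • x) 0
    have h0 : dist (e (R • x)) (e 0) = ‖e (R • x)‖ := by simp
    rw [dist_zero_right, norm_smul, hx, mul_one, Real.norm_of_nonneg hR.le] at h
    change R ≤ K * dist (e (R • x)) (e 0) at h
    rw [h0, mul_comm] at h
    exact le_of_mul_le_mul_right h hK0'
  have hγe : Continuous fun x => γ (e (R • x)) := by fun_prop
  have hγ0 : γ 0 = 0 := by
    have := hodd 0
    rw [neg_zero] at this
    rw [eq_neg_iff_add_eq_zero, ← two_smul ℝ] at this
    exact (smul_eq_zero.1 this).resolve_left two_ne_zero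
  obtain ⟨x, hxF, hxη⟩ := exists_zero_of_odd_of_even
    (F := fun x => R⁻¹ • L (γ (e (R • x)))) (by fun_prop)
    (fun x => by simp only [smul_neg, map_neg, hodd])
    (fun x hx i => by
      rw [hρ _ (hlarge x hx)]
      simp [hLe, hR.ne'])
    (η := fun x => ‖γ (e (R • x))‖ - r) (by fun_prop)
    (fun x => by simp only [smul_neg, map_neg, hodd, norm_neg])
    (by simp [hγ0, hr])
    (fun x hx => by
      have h := hlarge x hx
      rw [hρ _ h]
      have : ρ ≤ ‖(e (R • x) : X)‖ := h
      linarith)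
  refine ⟨e (R • x), ?_, hLZ _ ?_, sub_eq_zero.1 hxη⟩
  · by_contra! h
    have h1 := sub_eq_zero.1 hxη
    rw [hρ _ h.le] at h1
    have : ρ < ‖(e (R • x) : X)‖ := h
    linarith
  · simpa [hR.ne'] using hxF

theorem exists_ge_ne_bot_of_iSup_dense {X : Type*} [NormedAddCommGroup X] [NormedSpace ℝ X]
    (hinf : ¬ FiniteDimensional ℝ X) {Xs : ℕ → Submodule ℝ X}
    (hfin : ∀ i, FiniteDimensional ℝ (Xs i)) (hdense : (⨆ i, Xs i).topologicalClosure = ⊤)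
    (K : ℕ) : ∃ k ≥ K, Xs k ≠ ⊥ := by
  by_contra! h
  have hle : (⨆ i, Xs i) ≤ ⨆ i : Fin K, Xs i := by
    refine iSup_le fun i => ?_
    rcases lt_or_ge i K with hi | hi
    · exact le_iSup (fun i : Fin K => Xs i) ⟨i, hi⟩
    · rw [h i hi]; exact bot_le
  have hcl : (⨆ i : Fin K, Xs i) = ⊤ := by
    have hc := Submodule.closed_of_finiteDimensional (⨆ i : Fin K, Xs i)
    rw [eq_top_iff, ← hdense]
    exact Submodule.topologicalClosure_minimal _ hle hc
  have h1 : FiniteDimensional ℝ (⊤ : Submodule ℝ X) := hcl ▸ inferInstance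
  exact hinf (Module.Finite.equiv (Submodule.topEquiv (R := ℝ) (M := X)))

/-- A critical point at a level at least `M`. -/
theorem exists_critical_point_ge
    {X : Type*} [NormedAddCommGroup X] [NormedSpace ℝ X] [CompleteSpace X]
    {Y Z : Submodule ℝ X} [FiniteDimensional ℝ Y] (hZ : IsClosed (Z : Set X)) (hYZ : Y ⊔ Z = ⊤)
    (hinf : Y ⊓ Z ≠ ⊥) {φ : X → ℝ} (hφ : ContDiff ℝ 1 φ) (heven : ∀ u, φ (-u) = φ u)
    (hPS : ∀ c : ℝ, 0 < c → ∀ u : ℕ → X,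
      Tendsto (fun n => φ (u n)) atTop (𝓝 c) →
      Tendsto (fun n => ‖fderiv ℝ φ (u n)‖) atTop (𝓝 0) →
      ∃ σ : ℕ → ℕ, StrictMono σ ∧ ∃ x : X, Tendsto (fun n => u (σ n)) atTop (𝓝 x))
    {ρ r : ℝ} (hr : 0 < r) (hrρ : r < ρ) (hφY : ∀ u ∈ Y, ‖u‖ = ρ → φ u ≤ 0) {M : ℝ} (hM : 0 < M)
    (hφZ : ∀ u ∈ Z, ‖u‖ = r → M ≤ φ u) :
    ∃ u, fderiv ℝ φ u = 0 ∧ M ≤ φ u := by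
  obtain ⟨c, hMc, x, hx, hx'⟩ := exists_palaisSmale_of_minimax (ι := Y.subtypeL) hφ heven
    (hr.trans hrρ) (fun u hu => hφY u u.2 hu) hM (fun g hg => by
      obtain ⟨u, hu, huZ, hur⟩ := exists_mem_norm_eq_of_odd hZ hYZ hinf hr hrρ
        (γ := fun u => Y.subtypeL u + g u) (by fun_prop)
        (fun u => by simp only [map_neg, hg.1, neg_add])
        (fun u hu => by simp [hg.2 u hu])
      exact ⟨u, hu, hφZ _ huZ hur⟩)
  obtain ⟨σ, hσ, u, hu⟩ := hPS c (hM.trans_le hMc) x hx hx'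
  refine ⟨u, ?_, ?_⟩
  · have h1 := ((hφ.continuous_fderiv one_ne_zero).norm.tendsto u).comp hu
    exact norm_eq_zero.1 (tendsto_nhds_unique h1 (hx'.comp hσ.tendsto_atTop))
  · rw [tendsto_nhds_unique ((hφ.continuous.tendsto u).comp hu) (hx.comp hσ.tendsto_atTop)]
    exact hMc

/-- **Fountain Theorem** (Willem, Theorem 3.6).
`X` is an infinite-dimensional real Banach space which is the closure of the direct sum of a
sequence of finite-dimensional subspaces `Xs i`.  `Y k = Xs 0 ⊕ ⋯ ⊕ Xs k` and
`Z k = closure (⨁_{i ≥ k} Xs i)`.  If `φ` is a `C¹` even functional satisfying the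
Palais–Smale condition at every positive level, and for every `k` there are radii
`ρ k > r k > 0` such that `φ ≤ 0` on the sphere of radius `ρ k` in `Y k` while the infimum
of `φ` on the sphere of radius `r k` in `Z k` tends to `+∞`, then `φ` has a sequence of
critical points along which `φ` tends to `+∞`. -/
theorem fountain_theorem
    {X : Type*} [NormedAddCommGroup X] [NormedSpace ℝ X] [CompleteSpace X]
    (hinf : ¬ FiniteDimensional ℝ X)
    (Xs : ℕ → Submodule ℝ X)
    (hfin : ∀ i, FiniteDimensional ℝ (Xs i))
    (hindep : iSupIndep Xs)
    (hdense : (⨆ i, Xs i).topologicalClosure = ⊤)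
    (Y : ℕ → Submodule ℝ X) (hY : ∀ k, Y k = ⨆ i ≤ k, Xs i)
    (Z : ℕ → Submodule ℝ X) (hZ : ∀ k, Z k = (⨆ i ≥ k, Xs i).topologicalClosure)
    (φ : X → ℝ) (hφ : ContDiff ℝ 1 φ)
    (heven : ∀ u, φ (-u) = φ u)
    -- (A1) : the Palais–Smale condition at every level `c > 0`
    (hPS : ∀ c : ℝ, 0 < c → ∀ u : ℕ → X,
      Tendsto (fun n => φ (u n)) atTop (𝓝 c) →
      Tendsto (fun n => ‖fderiv ℝ φ (u n)‖) atTop (𝓝 0) →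
      ∃ σ : ℕ → ℕ, StrictMono σ ∧ ∃ x : X, Tendsto (fun n => u (σ n)) atTop (𝓝 x))
    (ρ r : ℕ → ℝ)
    (hρr : ∀ k, r k < ρ k) (hr : ∀ k, 0 < r k)
    -- (A2) : `a_k := max {φ u : u ∈ Y k, ‖u‖ = ρ k} ≤ 0`
    (hA2 : ∀ k, ∀ u ∈ Y k, ‖u‖ = ρ k → φ u ≤ 0)
    -- (A3) : `b_k := inf {φ u : u ∈ Z k, ‖u‖ = r k} → +∞` as `k → ∞`
    (hA3 : ∀ M : ℝ, ∃ K : ℕ, ∀ k ≥ K, ∀ u ∈ Z k, ‖u‖ = r k → M ≤ φ u) :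
    ∃ u : ℕ → X, (∀ k, fderiv ℝ φ (u k) = 0) ∧
      Tendsto (fun k => φ (u k)) atTop atTop := by
  have hcrit : ∀ n : ℕ, ∃ u, fderiv ℝ φ u = 0 ∧ (n : ℝ) ≤ φ u := by
    intro n
    obtain ⟨K, hK⟩ := hA3 (n + 1)
    obtain ⟨k, hkK, hk⟩ := exists_ge_ne_bot_of_iSup_dense hinf hfin hdense K
    have : FiniteDimensional ℝ (Y k) := by
      have : Y k = ⨆ i : Fin (k + 1), Xs i := by
        rw [hY]
        exact le_antisymm
          (iSup₂_le fun i hi => le_iSup (fun i : Fin (k + 1) => Xs i) ⟨i, Nat.lt_succ_of_le hi⟩)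
          (iSup_le fun i => le_iSup₂_of_le i.1 (Nat.le_of_lt_succ i.2) le_rfl)
      rw [this]
      infer_instance
    have hZc : IsClosed (Z k : Set X) := by
      rw [hZ]; exact Submodule.isClosed_topologicalClosure _
    have hXY : ∀ i ≤ k, Xs i ≤ Y k := fun i hi => by
      rw [hY]; exact le_iSup₂_of_le i hi le_rfl
    have hXZ : ∀ i ≥ k, Xs i ≤ Z k := fun i hi => by
      rw [hZ]
      exact (le_iSup₂_of_le (f := fun i _ => Xs i) i hi le_rfl).trans
        (Submodule.le_topologicalClosure _)
    have hYZ : Y k ⊔ Z k = ⊤ := by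
      have hc : IsClosed ((Y k ⊔ Z k : Submodule ℝ X) : Set X) := by
        rw [sup_comm]; exact Submodule.isClosed_sup_finiteDimensional _ _ hZc
      rw [eq_top_iff, ← hdense]
      refine Submodule.topologicalClosure_minimal _ (iSup_le fun i => ?_) hc
      rcases le_total i k with hi | hi
      · exact (hXY i hi).trans le_sup_left
      · exact (hXZ i hi).trans le_sup_right
    have hne : Y k ⊓ Z k ≠ ⊥ := fun h =>
      hk (le_bot_iff.1 (h ▸ le_inf (hXY k le_rfl) (hXZ k le_rfl)))
    obtain ⟨u, hu, hu'⟩ := exists_critical_point_ge hZc hYZ hne hφ heven hPS (hr k) (hρr k)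
      (hA2 k) (by positivity : (0 : ℝ) < n + 1) (hK k hkK)
    exact ⟨u, hu, by linarith⟩
  choose u hu hu' using hcrit
  exact ⟨u, hu, tendsto_atTop_mono hu' tendsto_natCast_atTop_atTop⟩
end

section
/- Define f : ℝ → ℝ by f(t) = 3|t|t − (15/2)|t|^{1/2}t + t and F : ℝ → ℝ by F(t) = |t|³ − 3|t|^{5/2} + t²/2. Then for every t ∈ ℝ, f(t)·t − 2F(t) = |t|³ − (3/2)|t|^{5/2}, and consequently f(t)·t − 2F(t) ≤ 0 for all t ∈ [−9/4, 9/4]. In particular, f does not satisfy the strict Ambrosetti–Rabinowitz-type condition 2F(t) < f(t)·t for all t ≠ 0. -/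
theorem rpow_five_halves {x : ℝ} (hx : 0 ≤ x) :
    x ^ ((5:ℝ)/2) = x ^ 2 * x ^ ((1:ℝ)/2) := by
  rw [show (5:ℝ)/2 = (2:ℕ) + 1/2 by norm_num,
    Real.rpow_add_of_nonneg hx (by positivity) (by norm_num), Real.rpow_natCast]

theorem cube_le_rpow_five_halves {x : ℝ} (hx : 0 ≤ x) (hx' : x ≤ 9/4) :
    x ^ 3 ≤ 3 / 2 * x ^ ((5:ℝ)/2) := by
  rw [rpow_five_halves hx, ← Real.sqrt_eq_rpow]
  have hs : √x ≤ 3/2 := Real.sqrt_le_iff.mpr ⟨by norm_num, by linarith⟩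
  have h : x ≤ 3/2 * √x := by
    nlinarith [Real.mul_self_sqrt hx, Real.sqrt_nonneg x]
  nlinarith [mul_le_mul_of_nonneg_left h (sq_nonneg x)]

/-- For `f(t) = 3|t|t - (15/2)|t|^{1/2}t + t` and `F(t) = |t|³ - 3|t|^{5/2} + t²/2` one has
`f(t)·t - 2F(t) = |t|³ - (3/2)|t|^{5/2}`, which is `≤ 0` on `[-9/4, 9/4]`; in particular the
strict Ambrosetti–Rabinowitz condition `2F(t) < f(t)·t` for all `t ≠ 0` fails. -/
theorem example_fails_AR
    (f F : ℝ → ℝ)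
    (hf : ∀ t, f t = 3 * |t| * t - 15 / 2 * |t| ^ ((1:ℝ)/2) * t + t)
    (hF : ∀ t, F t = |t| ^ (3:ℕ) - 3 * |t| ^ ((5:ℝ)/2) + t ^ 2 / 2) :
    (∀ t : ℝ, f t * t - 2 * F t = |t| ^ (3:ℕ) - 3 / 2 * |t| ^ ((5:ℝ)/2)) ∧
      (∀ t ∈ Set.Icc (-(9/4) : ℝ) (9/4 : ℝ), f t * t - 2 * F t ≤ 0) ∧
      ¬ (∀ t : ℝ, t ≠ 0 → 2 * F t < f t * t) := by
  have key : ∀ t : ℝ, f t * t - 2 * F t = |t| ^ (3:ℕ) - 3 / 2 * |t| ^ ((5:ℝ)/2) := by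
    intro t
    rw [hf, hF, rpow_five_halves (abs_nonneg t)]
    linear_combination (15 / 2 * |t| ^ ((1:ℝ)/2) - 3 * |t|) * sq_abs t
  have nonpos : ∀ t ∈ Set.Icc (-(9/4) : ℝ) (9/4 : ℝ), f t * t - 2 * F t ≤ 0 := by
    intro t ht
    rw [key]
    exact sub_nonpos.mpr (cube_le_rpow_five_halves (abs_nonneg t) (abs_le.mpr ht))
  refine ⟨key, nonpos, fun h => ?_⟩
  have h₁ := nonpos 1 ⟨by norm_num, by norm_num⟩
  linarith [h 1 one_ne_zero]
end
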